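/- The following are equivalent for a ring R: (1) every coneat exact sequence of left R-modules is pure exact; (2) every pure injective left R-module is coneat injective; (3) every pure injective left R-module is quasi coneat injective; (4) every pure injective left R-module is coneat quasi injective. -/

import Mathlib

/-!
Basic notions from the theory of coneat exact sequences.

A short exact sequence `0 → A → B → C → 0` of left `R`-modules is *coneat exact* if for every
simple right `R`-module `S` the induced map `S ⊗[R] A → S ⊗[R] B` is injective.  Since every
simple right `R`-module is isomorphic to `R ⧸ I` for a maximal right ideal `I` (realized below
as a left ideal `I : Ideal Rᵐᵒᵖ`), and since `(R ⧸ I) ⊗[R] B ≅ B ⧸ I•B` (as abelian groups,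
where `I•B` is the additive subgroup generated by the products `i • b`, `i ∈ I`, `b ∈ B`),
this is equivalent to the elementwise condition `A ∩ I•B ⊆ I•A` for every maximal right
ideal `I`, which is the formulation used here (Mathlib has no tensor product of a right module
with a left module over a noncommutative ring).
-/

universe u v

section Defs

variable (R : Type u) [Ring R]

/-- The additive subgroup of a left `R`-module `B` generated by the products `i • n` with
`i` in a right ideal `I` (realized as a left ideal of `Rᵐᵒᵖ`) and `n ∈ N`. -/
def rIdealSMul {B : Type v} [AddCommGroup B] [Module R B] (I : Ideal Rᵐᵒᵖ) (N : Set B) :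
    AddSubgroup B :=
  AddSubgroup.closure {x : B | ∃ i ∈ I, ∃ n ∈ N, x = MulOpposite.unop i • n}

/-- `A` is a *coneat submodule* of `B` : the sequence `0 → A → B → B ⧸ A → 0` remains exact
after tensoring with every simple right `R`-module, i.e. `A ∩ I•B ⊆ I•A` for every maximal
right ideal `I` of `R`. -/
def IsConeatSubmodule {B : Type v} [AddCommGroup B] [Module R B] (A : Submodule R B) : Prop :=
  ∀ I : Ideal Rᵐᵒᵖ, I.IsMaximal → ∀ a : B, a ∈ A →
    a ∈ rIdealSMul R I (Set.univ : Set B) → a ∈ rIdealSMul R I (A : Set B)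

/-- The short exact sequence `0 → A –f→ B –g→ C → 0` is *coneat exact*. -/
def IsConeatExactSeq {A B C : Type v} [AddCommGroup A] [Module R A] [AddCommGroup B] [Module R B]
    [AddCommGroup C] [Module R C] (f : A →ₗ[R] B) (g : B →ₗ[R] C) : Prop :=
  Function.Injective f ∧ Function.Surjective g ∧ Function.Exact f g ∧
    IsConeatSubmodule R (LinearMap.range f)

/-- A left `R`-module `M` is *coneat injective* if for every coneat submodule `A` of a left
`R`-module `B`, every homomorphism `A → M` extends to `B`. -/
def IsConeatInjective (M : Type v) [AddCommGroup M] [Module R M] : Prop :=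
  ∀ (B : ModuleCat.{v} R) (A : Submodule R B), IsConeatSubmodule R A →
    ∀ f : A →ₗ[R] M, ∃ g : B →ₗ[R] M, g.comp A.subtype = f

/-- `e : M → E` is a *coneat injective envelope* of `M` : `e` is injective, `E` is coneat
injective, every homomorphism from `M` to a coneat injective module factors through `e`, and
every endomorphism `f` of `E` with `f ∘ e = e` is an automorphism. -/
def IsConeatInjectiveEnvelope {M E : Type v} [AddCommGroup M] [Module R M] [AddCommGroup E]
    [Module R E] (e : M →ₗ[R] E) : Prop :=
  Function.Injective e ∧ IsConeatInjective R E ∧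
    (∀ (C : ModuleCat.{v} R), IsConeatInjective R C → ∀ g : M →ₗ[R] C,
      ∃ h : E →ₗ[R] C, h.comp e = g) ∧
    (∀ f : E →ₗ[R] E, f.comp e = e → Function.Bijective f)

/-- `M` is *`N`-coneat injective* if every homomorphism from a coneat submodule of `N`
to `M` extends to `N`. -/
def IsRelConeatInjective (M N : Type v) [AddCommGroup M] [Module R M] [AddCommGroup N]
    [Module R N] : Prop :=
  ∀ K : Submodule R N, IsConeatSubmodule R K →
    ∀ f : K →ₗ[R] M, ∃ g : N →ₗ[R] M, g.comp K.subtype = f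

/-- `M` is *quasi coneat injective* if it is `M`-coneat injective. -/
def IsQuasiConeatInjective (M : Type v) [AddCommGroup M] [Module R M] : Prop :=
  IsRelConeatInjective R M M

/-- `M` is *coneat-`N`-injective* if for (some, equivalently every) coneat injective envelope
`e : M → E`, every homomorphism `f : N → E` satisfies `f (N) ⊆ e (M)`. -/
def IsConeatRelInjective (M N : Type v) [AddCommGroup M] [Module R M] [AddCommGroup N]
    [Module R N] : Prop :=
  ∀ (E : ModuleCat.{v} R) (e : M →ₗ[R] E), IsConeatInjectiveEnvelope R e →
    ∀ f : N →ₗ[R] E, ∀ n : N, f n ∈ LinearMap.range e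

/-- `M` is *coneat quasi injective* if it is coneat-`M`-injective, i.e. fully invariant in its
coneat injective envelope. -/
def IsConeatQuasiInjective (M : Type v) [AddCommGroup M] [Module R M] : Prop :=
  IsConeatRelInjective R M M

/-- `A` is a *pure submodule* of `B` : the sequence `0 → A → B → B ⧸ A → 0` remains exact after
tensoring with every right `R`-module; elementwise (Cohn's criterion): every finite system of
linear equations `aᵢ = ∑ⱼ rᵢⱼ • xⱼ` with constants in `A` which is solvable in `B` is solvable
in `A`. -/
def IsPureSubmodule {B : Type v} [AddCommGroup B] [Module R B] (A : Submodule R B) : Prop :=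
  ∀ (m n : ℕ) (r : Fin m → Fin n → R) (a : Fin m → A),
    (∃ b : Fin n → B, ∀ i, (a i : B) = ∑ j, r i j • b j) →
    ∃ a' : Fin n → A, ∀ i, (a i : B) = ∑ j, r i j • (a' j : B)

/-- The short exact sequence `0 → A –f→ B –g→ C → 0` is *pure exact*. -/
def IsPureExactSeq {A B C : Type v} [AddCommGroup A] [Module R A] [AddCommGroup B] [Module R B]
    [AddCommGroup C] [Module R C] (f : A →ₗ[R] B) (g : B →ₗ[R] C) : Prop :=
  Function.Injective f ∧ Function.Surjective g ∧ Function.Exact f g ∧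
    IsPureSubmodule R (LinearMap.range f)

/-- A left `R`-module `M` is *pure injective* if for every pure submodule `A` of a left
`R`-module `B`, every homomorphism `A → M` extends to `B`. -/
def IsPureInjective (M : Type v) [AddCommGroup M] [Module R M] : Prop :=
  ∀ (B : ModuleCat.{v} R) (A : Submodule R B), IsPureSubmodule R A →
    ∀ f : A →ₗ[R] M, ∃ g : B →ₗ[R] M, g.comp A.subtype = f

/-- A right `R`-module `S` (i.e. a left `Rᵐᵒᵖ`-module) is *flat*, expressed through the
equational criterion (which over any ring is equivalent to `S ⊗[R] —` preserving injections):
every relation `∑ᵢ sᵢ aᵢ = 0` in `S` comes from relations in `R`. -/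
def IsFlatRightModule (S : Type v) [AddCommGroup S] [Module Rᵐᵒᵖ S] : Prop :=
  ∀ (m : ℕ) (a : Fin m → R) (s : Fin m → S),
    (∑ i, MulOpposite.op (a i) • s i) = 0 →
    ∃ (n : ℕ) (b : Fin n → Fin m → R) (t : Fin n → S),
      (∀ i, s i = ∑ j, MulOpposite.op (b j i) • t j) ∧ (∀ j, ∑ i, b j i * a i = 0)

/-- A left `R`-module `C` is *coneat flat* if `C ≅ B ⧸ A` for some coneat submodule `A ≤ B`. -/
def IsConeatFlat (C : Type v) [AddCommGroup C] [Module R C] : Prop :=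
  ∃ (B : ModuleCat.{v} R) (A : Submodule R B),
    IsConeatSubmodule R A ∧ Nonempty ((B ⧸ A) ≃ₗ[R] C)

end Defs

/-! ### Injectivity relative to a class of submodules -/

section RelativeInjectivity

variable {R : Type u} [Ring R]

/-- Injectivity of a left `R`-module relative to a class `P` of submodules. -/
def IsInjectiveRel (P : ∀ B : ModuleCat.{u} R, Submodule R B → Prop) (M : Type u)
    [AddCommGroup M] [Module R M] : Prop :=
  ∀ (B : ModuleCat.{u} R) (A : Submodule R B), P B A →
    ∀ f : A →ₗ[R] M, ∃ g : B →ₗ[R] M, g.comp A.subtype = f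

variable {P : ∀ B : ModuleCat.{u} R, Submodule R B → Prop}
  {M N : Type u} [AddCommGroup M] [Module R M] [AddCommGroup N] [Module R N]

theorem IsInjectiveRel.of_retract (h : IsInjectiveRel P M) (i : N →ₗ[R] M) (r : M →ₗ[R] N)
    (hri : r.comp i = LinearMap.id) : IsInjectiveRel P N := by
  intro B A hA f
  obtain ⟨g, hg⟩ := h B A hA (i.comp f)
  refine ⟨r.comp g, ?_⟩
  rw [LinearMap.comp_assoc, hg, ← LinearMap.comp_assoc, hri, LinearMap.id_comp]

theorem IsInjectiveRel.prod (hM : IsInjectiveRel P M) (hN : IsInjectiveRel P N) :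
    IsInjectiveRel P (M × N) := by
  intro B A hA f
  obtain ⟨g, hg⟩ := hM B A hA ((LinearMap.fst R M N).comp f)
  obtain ⟨k, hk⟩ := hN B A hA ((LinearMap.snd R M N).comp f)
  exact ⟨g.prod k, LinearMap.ext fun a =>
    Prod.ext (LinearMap.congr_fun hg a) (LinearMap.congr_fun hk a)⟩

theorem IsInjectiveRel.pi {ι : Type u} {X : ι → Type u} [∀ i, AddCommGroup (X i)]
    [∀ i, Module R (X i)] (h : ∀ i, IsInjectiveRel P (X i)) : IsInjectiveRel P (∀ i, X i) := by
  intro B A hA f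
  choose g hg using fun i => h i B A hA ((LinearMap.proj i).comp f)
  exact ⟨LinearMap.pi g, LinearMap.ext fun a => funext fun i => LinearMap.congr_fun (hg i) a⟩

/-- Extension along an injective map, from extension along the inclusion of its range. -/
theorem exists_extension_of_range {A B : Type*} [AddCommGroup A] [Module R A] [AddCommGroup B]
    [Module R B] {j : A →ₗ[R] B} (hj : Function.Injective j)
    (h : ∀ f : LinearMap.range j →ₗ[R] M,
      ∃ g : B →ₗ[R] M, g.comp (LinearMap.range j).subtype = f) (f : A →ₗ[R] M) :
    ∃ g : B →ₗ[R] M, g.comp j = f := by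
  obtain ⟨g, hg⟩ := h (f.comp (LinearEquiv.ofInjective j hj).symm.toLinearMap)
  refine ⟨g, LinearMap.ext fun a => ?_⟩
  have := LinearMap.congr_fun hg (LinearEquiv.ofInjective j hj a)
  simpa using this

end RelativeInjectivity

/-! ### Characters with values in the circle -/

section Characters

variable {G : Type*} [AddCommGroup G]

theorem exists_circle_character_extension {A : Type*} [AddCommGroup A] (j : A →+ G)
    (H : AddSubgroup G) (χ : A →+ UnitAddCircle) (h : ∀ a, j a ∈ H → χ a = 0) :
    ∃ ψ : G →+ UnitAddCircle, (∀ x ∈ H, ψ x = 0) ∧ ∀ a, ψ (j a) = χ a := by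
  let φ := (QuotientAddGroup.mk' H).comp j
  have hφ : φ.ker ≤ χ.ker := fun a ha =>
    h a ((QuotientAddGroup.eq_zero_iff _).1 (show ((j a : G) : G ⧸ H) = 0 from ha))
  obtain ⟨ψ, hψ⟩ := (Module.Baer.of_divisible UnitAddCircle).extension_property_addMonoidHom
    (QuotientAddGroup.kerLift φ) (QuotientAddGroup.kerLift_injective φ)
    (QuotientAddGroup.lift φ.ker χ hφ)
  refine ⟨ψ.comp (QuotientAddGroup.mk' H), fun x hx => ?_, fun a => ?_⟩
  · exact (congrArg ψ ((QuotientAddGroup.eq_zero_iff x).2 hx)).trans (map_zero ψ)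
  · exact DFunLike.congr_fun hψ (a : A ⧸ φ.ker)

theorem exists_circle_character_of_notMem (H : AddSubgroup G) {x : G} (hx : x ∉ H) :
    ∃ χ : G →+ UnitAddCircle, (∀ y ∈ H, χ y = 0) ∧ χ x ≠ 0 := by
  have hx' : (x : G ⧸ H) ≠ 0 := fun h => hx ((QuotientAddGroup.eq_zero_iff x).1 h)
  obtain ⟨c, hc⟩ := CharacterModule.exists_character_apply_ne_zero_of_ne_zero hx'
  let κ : AddCircle (1 : ℚ) →+ UnitAddCircle :=
    QuotientAddGroup.map _ _ (Rat.castHom ℝ).toAddMonoidHom (by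
      rw [AddSubgroup.zmultiples_le]
      exact ⟨1, by simp⟩)
  have hκ : ∀ q, κ q = 0 → q = 0 := by
    intro q hq
    induction q using QuotientAddGroup.induction_on with
    | H q =>
      obtain ⟨n, hn⟩ := (AddCircle.coe_eq_zero_iff (1 : ℝ)).1
        (show (((q : ℚ) : ℝ) : UnitAddCircle) = 0 from hq)
      refine (AddCircle.coe_eq_zero_iff (1 : ℚ)).2 ⟨n, ?_⟩
      have : ((n • (1 : ℚ) : ℚ) : ℝ) = (q : ℝ) := by simpa using hn
      exact_mod_cast this
  exact ⟨(κ.comp c).comp (QuotientAddGroup.mk' H), fun y hy =>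
    (congrArg (κ.comp c) ((QuotientAddGroup.eq_zero_iff y).2 hy)).trans (map_zero (κ.comp c)),
    fun h => hc (hκ _ h)⟩

end Characters

/-! ### Pure injectivity of compact modules -/

section PureInjective

variable {R : Type u} [Ring R]

theorem IsPureSubmodule.exists_solution {B : Type v} [AddCommGroup B] [Module R B]
    {A : Submodule R B} (hA : IsPureSubmodule R A) {ι κ : Type*} [Fintype ι] [Fintype κ]
    (r : ι → κ → R) (a : ι → A) (b : κ → B) (h : ∀ i, (a i : B) = ∑ j, r i j • b j) :
    ∃ a' : κ → A, ∀ i, a i = ∑ j, r i j • a' j := by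
  let eι := Fintype.equivFin ι
  let eκ := Fintype.equivFin κ
  obtain ⟨a', ha'⟩ := hA _ _ (fun i j => r (eι.symm i) (eκ.symm j)) (fun i => a (eι.symm i))
    ⟨fun j => b (eκ.symm j), fun i => by
      rw [h, ← Equiv.sum_comp eκ.symm]⟩
  refine ⟨fun j => a' (eκ j), fun i => Subtype.ext ?_⟩
  have := ha' (eι i)
  rw [← Equiv.sum_comp eκ] at this
  simpa using this

theorem isPureInjective_of_compactSpace (M : Type u) [AddCommGroup M] [Module R M]
    [TopologicalSpace M] [ContinuousAdd M] [ContinuousConstSMul R M] [CompactSpace M]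
    [T2Space M] : IsPureInjective R M := by
  classical
  intro B A hA f
  let t (p : {p : (B →₀ R) × A // Finsupp.linearCombination R id p.1 = (p.2 : B)}) :
      Set (B → M) := {g | Finsupp.linearCombination R g p.1.1 = f p.1.2}
  have ht : (⋂ p, t p).Nonempty := by
    refine CompactSpace.iInter_nonempty (fun p => ?_) (fun s => ?_)
    · refine isClosed_eq ?_ continuous_const
      simp only [Finsupp.linearCombination_apply, Finsupp.sum]
      fun_prop
    · let V : Finset B := s.biUnion fun p => p.1.1.support
      have hV (g : B → M) (p) (hp : p ∈ s) :
          Finsupp.linearCombination R g p.1.1 = ∑ v : V, p.1.1 v • g v := by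
        rw [Finsupp.linearCombination_apply, Finset.sum_coe_sort V fun v => p.1.1 v • g v]
        exact Finsupp.sum_of_support_subset _
          (Finset.subset_biUnion_of_mem (fun p => p.1.1.support) hp) _ (by simp)
      have hV' (p) (hp : p ∈ s) : (p.1.2 : B) = ∑ v : V, p.1.1 v • (v : B) := by
        rw [← p.2, Finsupp.linearCombination_apply,
          Finset.sum_coe_sort V fun v => p.1.1 v • v]
        exact Finsupp.sum_of_support_subset _
          (Finset.subset_biUnion_of_mem (fun p => p.1.1.support) hp) _ (by simp)
      obtain ⟨a', ha'⟩ := hA.exists_solution (fun (p : s) (v : V) => p.1.1.1 v)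
        (fun p => p.1.1.2) (fun v => v) (fun p => hV' p.1 p.2)
      refine ⟨fun b => if h : b ∈ V then f (a' ⟨b, h⟩) else 0, ?_⟩
      refine Set.mem_iInter₂.2 fun p hp => ?_
      change Finsupp.linearCombination R _ p.1.1 = f p.1.2
      rw [hV _ p hp, ha' ⟨p, hp⟩, map_sum]
      exact Finset.sum_congr rfl fun v _ => by simp
  obtain ⟨g, hg⟩ := ht
  have key (c : B →₀ R) (a : A) (h : Finsupp.linearCombination R id c = (a : B)) :
      Finsupp.linearCombination R g c = f a := Set.mem_iInter.1 hg ⟨(c, a), h⟩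
  refine ⟨{ toFun := g, map_add' := fun x y => ?_, map_smul' := fun r x => ?_ },
    LinearMap.ext fun a => ?_⟩
  · have := key (Finsupp.single (x + y) 1 - (Finsupp.single x 1 + Finsupp.single y 1)) 0
      (by simp)
    simpa [sub_eq_zero] using this
  · have := key (Finsupp.single (r • x) 1 - Finsupp.single x r) 0 (by simp)
    simpa [sub_eq_zero] using this
  · simpa using key (Finsupp.single (a : B) 1) a (by simp)

end PureInjective

/-! ### Circle duals of right modules -/

/-- The group of characters of a right `R`-module with values in the circle, regarded as a
compact left `R`-module. -/
def CircleDual (N : Type*) [AddCommGroup N] : Type _ := N →+ UnitAddCircle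

namespace CircleDual

variable {R : Type*} [Ring R] {N : Type*} [AddCommGroup N]

noncomputable instance : AddCommGroup (CircleDual N) :=
  inferInstanceAs (AddCommGroup (N →+ UnitAddCircle))

instance : FunLike (CircleDual N) N UnitAddCircle :=
  inferInstanceAs (FunLike (N →+ UnitAddCircle) N UnitAddCircle)

instance : AddMonoidHomClass (CircleDual N) N UnitAddCircle :=
  inferInstanceAs (AddMonoidHomClass (N →+ UnitAddCircle) N UnitAddCircle)

@[ext]
theorem ext {φ ψ : CircleDual N} (h : ∀ n, φ n = ψ n) : φ = ψ := DFunLike.ext _ _ h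

@[simp]
theorem add_apply (φ ψ : CircleDual N) (n : N) : (φ + ψ) n = φ n + ψ n := rfl

@[simp]
theorem zero_apply (n : N) : (0 : CircleDual N) n = 0 := rfl

noncomputable instance [Module Rᵐᵒᵖ N] : Module R (CircleDual N) where
  smul r φ := AddMonoidHom.comp φ (DistribSMul.toAddMonoidHom N (MulOpposite.op r))
  one_smul φ := ext fun n => congrArg φ (one_smul Rᵐᵒᵖ n)
  mul_smul r s φ := ext fun n => congrArg φ (mul_smul (MulOpposite.op s) (MulOpposite.op r) n)
  smul_zero _ := rfl
  smul_add _ _ _ := rfl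
  add_smul r s φ := ext fun n =>
    (congrArg φ (add_smul (MulOpposite.op r) (MulOpposite.op s) n)).trans (map_add φ _ _)
  zero_smul φ := ext fun n => (congrArg φ (zero_smul Rᵐᵒᵖ n)).trans (map_zero φ)

@[simp]
theorem smul_apply [Module Rᵐᵒᵖ N] (r : R) (φ : CircleDual N) (n : N) :
    (r • φ) n = φ (MulOpposite.op r • n) := rfl

instance : TopologicalSpace (CircleDual N) :=
  TopologicalSpace.induced (fun φ : CircleDual N => (φ : N → UnitAddCircle)) inferInstance

theorem isClosedEmbedding_coe :
    Topology.IsClosedEmbedding (fun φ : CircleDual N => (φ : N → UnitAddCircle)) :=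
  ⟨⟨⟨rfl⟩, DFunLike.coe_injective⟩, AddMonoidHom.isClosed_range_coe N UnitAddCircle⟩

theorem continuous_eval (n : N) : Continuous fun φ : CircleDual N => φ n :=
  (continuous_apply n).comp isClosedEmbedding_coe.continuous

theorem continuous_of_eval {X : Type*} [TopologicalSpace X] {f : X → CircleDual N}
    (h : ∀ n, Continuous fun x => f x n) : Continuous f :=
  continuous_induced_rng.2 (continuous_pi h)

instance : CompactSpace (CircleDual N) := isClosedEmbedding_coe.compactSpace

instance : T2Space (CircleDual N) := isClosedEmbedding_coe.isEmbedding.t2Space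

instance : ContinuousAdd (CircleDual N) :=
  ⟨continuous_of_eval fun n =>
    ((continuous_eval n).comp continuous_fst).add ((continuous_eval n).comp continuous_snd)⟩

instance [Module Rᵐᵒᵖ N] : ContinuousConstSMul R (CircleDual N) :=
  ⟨fun r => continuous_of_eval fun n => continuous_eval (MulOpposite.op r • n)⟩

/-- Every character of a left module `M` that kills `J • M` induces a homomorphism from `M` to
the circle dual of the right module `R ⧸ J`. -/
noncomputable def ofCharacter {M : Type*} [AddCommGroup M] [Module R M] (J : Ideal Rᵐᵒᵖ)
    (χ : M →+ UnitAddCircle) (h : ∀ i ∈ J, ∀ m : M, χ (MulOpposite.unop i • m) = 0) :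
    M →ₗ[R] CircleDual (Rᵐᵒᵖ ⧸ J) where
  toFun m := QuotientAddGroup.lift J.toAddSubgroup
    { toFun := fun x => χ (MulOpposite.unop x • m)
      map_zero' := by simp
      map_add' := fun x y => by simp [add_smul] } fun i hi => h i hi m
  map_add' m m' := ext fun x => by
    induction x using Submodule.Quotient.induction_on with
    | H x => exact (congrArg χ (smul_add _ m m')).trans (map_add χ _ _)
  map_smul' r m := ext fun x => by
    induction x using Submodule.Quotient.induction_on with
    | H x => exact congrArg χ (mul_smul (MulOpposite.unop x) r m).symm

theorem ofCharacter_apply_mk {M : Type*} [AddCommGroup M] [Module R M] (J : Ideal Rᵐᵒᵖ)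
    (χ : M →+ UnitAddCircle) (h : ∀ i ∈ J, ∀ m : M, χ (MulOpposite.unop i • m) = 0)
    (m : M) (x : Rᵐᵒᵖ) :
    ofCharacter J χ h m (Submodule.Quotient.mk x) = χ (MulOpposite.unop x • m) := rfl

end CircleDual

/-! ### Coneat submodules -/

section Coneat

variable {R : Type u} [Ring R]

theorem smul_mem_rIdealSMul {B : Type v} [AddCommGroup B] [Module R B] {I : Ideal Rᵐᵒᵖ}
    {N : Set B} {i : Rᵐᵒᵖ} (hi : i ∈ I) {n : B} (hn : n ∈ N) :
    MulOpposite.unop i • n ∈ rIdealSMul R I N :=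
  AddSubgroup.subset_closure ⟨i, hi, n, hn, rfl⟩

theorem rIdealSMul_le {B : Type v} [AddCommGroup B] [Module R B] {I : Ideal Rᵐᵒᵖ} {N : Set B}
    {H : AddSubgroup B} (h : ∀ i ∈ I, ∀ n ∈ N, MulOpposite.unop i • n ∈ H) :
    rIdealSMul R I N ≤ H := by
  refine (AddSubgroup.closure_le _).2 ?_
  rintro _ ⟨i, hi, n, hn, rfl⟩
  exact h i hi n hn

theorem map_mem_rIdealSMul {B C : Type*} [AddCommGroup B] [Module R B] [AddCommGroup C]
    [Module R C] (f : B →ₗ[R] C) {I : Ideal Rᵐᵒᵖ} {N : Set B} {N' : Set C}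
    (hf : Set.MapsTo f N N') {x : B} (hx : x ∈ rIdealSMul R I N) : f x ∈ rIdealSMul R I N' :=
  rIdealSMul_le (H := (rIdealSMul R I N').comap f.toAddMonoidHom)
    (fun i hi n hn => by
      change f (MulOpposite.unop i • n) ∈ rIdealSMul R I N'
      rw [map_smul]
      exact smul_mem_rIdealSMul hi (hf hn)) hx

theorem mem_rIdealSMul_of_map_mem {B C : Type*} [AddCommGroup B] [Module R B] [AddCommGroup C]
    [Module R C] {f : B →ₗ[R] C} (hf : Function.Injective f) {I : Ideal Rᵐᵒᵖ} {x : B}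
    (hx : f x ∈ rIdealSMul R I (LinearMap.range f : Set C)) :
    x ∈ rIdealSMul R I (Set.univ : Set B) := by
  have : rIdealSMul R I (LinearMap.range f : Set C) ≤
      (rIdealSMul R I (Set.univ : Set B)).map f.toAddMonoidHom := by
    refine rIdealSMul_le ?_
    rintro i hi _ ⟨b, rfl⟩
    exact ⟨_, smul_mem_rIdealSMul hi (Set.mem_univ b), map_smul f _ b⟩
  obtain ⟨b, hb, hbx⟩ := this hx
  exact hf hbx ▸ hb

theorem IsConeatSubmodule.mem_rIdealSMul {B : Type v} [AddCommGroup B] [Module R B]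
    {A : Submodule R B} (hA : IsConeatSubmodule R A) {J : Ideal Rᵐᵒᵖ}
    (hJ : J = ⊥ ∨ J.IsMaximal) {a : B} (ha : a ∈ A)
    (haJ : a ∈ rIdealSMul R J (Set.univ : Set B)) : a ∈ rIdealSMul R J (A : Set B) := by
  rcases hJ with rfl | hJ
  · have : rIdealSMul R ⊥ (Set.univ : Set B) ≤ ⊥ :=
      rIdealSMul_le fun i hi n _ => by simp [(Submodule.mem_bot _).1 hi]
    rw [(AddSubgroup.mem_bot).1 (this haJ)]
    exact zero_mem _
  · exact hA J hJ a ha haJ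

theorem isConeatInjective_circleDual {J : Ideal Rᵐᵒᵖ} (hJ : J = ⊥ ∨ J.IsMaximal) :
    IsConeatInjective R (CircleDual (Rᵐᵒᵖ ⧸ J)) := by
  intro B A hA f
  let χ : A →+ UnitAddCircle :=
    { toFun := fun a => f a (Submodule.Quotient.mk 1)
      map_zero' := by simp
      map_add' := by simp }
  have hχ (a : A) (x : Rᵐᵒᵖ) :
      χ (MulOpposite.unop x • a) = f a (Submodule.Quotient.mk x) := by
    change f (MulOpposite.unop x • a) (Submodule.Quotient.mk 1) = _
    rw [map_smul, CircleDual.smul_apply, ← Submodule.Quotient.mk_smul]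
    simp
  obtain ⟨ψ, hψ, hψχ⟩ := exists_circle_character_extension A.subtype.toAddMonoidHom
    (rIdealSMul R J Set.univ) χ fun a ha => by
      have h : rIdealSMul R J (A : Set B) ≤ χ.ker.map A.subtype.toAddMonoidHom :=
        rIdealSMul_le fun i hi n hn => ⟨MulOpposite.unop i • ⟨n, hn⟩, by
          change χ _ = 0
          rw [hχ, (Submodule.Quotient.mk_eq_zero J).2 hi, map_zero], rfl⟩
      obtain ⟨a', ha', haa'⟩ := h (hA.mem_rIdealSMul hJ a.2 ha)
      rw [← show a' = a from Subtype.ext haa']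
      exact ha'
  refine ⟨CircleDual.ofCharacter J ψ fun i hi b =>
    hψ _ (smul_mem_rIdealSMul hi (Set.mem_univ b)), LinearMap.ext fun a => ?_⟩
  refine CircleDual.ext fun x => ?_
  induction x using Submodule.Quotient.induction_on with
  | H x => exact (hψχ (MulOpposite.unop x • a)).trans (hχ a x)

/-- Every module embeds as a coneat submodule in a compact coneat injective module. -/
theorem exists_compact_coneatInjective_extension (M : Type u) [AddCommGroup M] [Module R M] :
    ∃ (E : ModuleCat.{u} R) (e : M →ₗ[R] E) (_ : TopologicalSpace E), ContinuousAdd E ∧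
      ContinuousConstSMul R E ∧ CompactSpace E ∧ T2Space E ∧ Function.Injective e ∧
      IsConeatSubmodule R (LinearMap.range e) ∧ IsConeatInjective R E := by
  let ι := Σ J : {J : Ideal Rᵐᵒᵖ // J = ⊥ ∨ J.IsMaximal},
    {χ : M →+ UnitAddCircle // ∀ i ∈ J.1, ∀ m : M, χ (MulOpposite.unop i • m) = 0}
  let E := ∀ p : ι, CircleDual (Rᵐᵒᵖ ⧸ p.1.1)
  let e : M →ₗ[R] E := LinearMap.pi fun p => CircleDual.ofCharacter p.1.1 p.2.1 p.2.2
  have he (p : ι) (m : M) : e m p (Submodule.Quotient.mk 1) = p.2.1 m :=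
    (CircleDual.ofCharacter_apply_mk _ _ p.2.2 m 1).trans (by simp)
  have hsep (J : Ideal Rᵐᵒᵖ) (hJ : J = ⊥ ∨ J.IsMaximal) (m : M)
      (hm : e m ∈ rIdealSMul R J (Set.univ : Set E)) :
      m ∈ rIdealSMul R J (Set.univ : Set M) := by
    by_contra hmJ
    obtain ⟨χ, hχ, hχm⟩ := exists_circle_character_of_notMem _ hmJ
    let p : ι := ⟨⟨J, hJ⟩, χ, fun i hi m => hχ _ (smul_mem_rIdealSMul hi (Set.mem_univ m))⟩
    let ev : E →+ UnitAddCircle :=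
      { toFun := fun x => x p (Submodule.Quotient.mk 1)
        map_zero' := rfl
        map_add' := fun _ _ => rfl }
    have : rIdealSMul R J (Set.univ : Set E) ≤ ev.ker := rIdealSMul_le fun i hi x _ => by
      change (MulOpposite.unop i • x p) (Submodule.Quotient.mk 1) = 0
      rw [CircleDual.smul_apply, ← Submodule.Quotient.mk_smul]
      simp [(Submodule.Quotient.mk_eq_zero J).2 hi]
    exact hχm ((he p m).symm.trans (this hm))
  refine ⟨ModuleCat.of R E, e, inferInstanceAs (TopologicalSpace E),
    inferInstanceAs (ContinuousAdd E), inferInstanceAs (ContinuousConstSMul R E),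
    inferInstanceAs (CompactSpace E), inferInstanceAs (T2Space E), ?_, ?_, ?_⟩
  · refine (injective_iff_map_eq_zero e).2 fun m hm => ?_
    have h := hsep ⊥ (Or.inl rfl) m (hm ▸ zero_mem _)
    have : rIdealSMul R ⊥ (Set.univ : Set M) ≤ ⊥ :=
      rIdealSMul_le fun i hi n _ => by simp [(Submodule.mem_bot _).1 hi]
    exact AddSubgroup.mem_bot.1 (this h)
  · rintro I hI _ ⟨m, rfl⟩ hm
    exact map_mem_rIdealSMul e (fun x _ => LinearMap.mem_range_self e x) (hsep I (Or.inr hI) m hm)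
  · exact IsInjectiveRel.pi (P := fun _ A => IsConeatSubmodule R A)
      fun p : ι => isConeatInjective_circleDual p.1.2

end Coneat

/-! ### Pure embeddings into pure injective modules -/

section PureEmbedding

variable {R : Type u} [Ring R]

/-- Every module maps to a pure injective module in such a way that finite systems of linear
equations solvable in the latter are solvable in the former. -/
theorem exists_pureInjective_reflecting_solutions (M : Type u) [AddCommGroup M] [Module R M] :
    ∃ (P : ModuleCat.{u} R) (e : M →ₗ[R] P), IsPureInjective R P ∧
      ∀ (m n : ℕ) (r : Fin m → Fin n → R) (a : Fin m → M),
        (∃ b : Fin n → P, ∀ i, e (a i) = ∑ j, r i j • b j) →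
        ∃ a' : Fin n → M, ∀ i, a i = ∑ j, r i j • a' j := by
  let : Module Rᵐᵒᵖ (M →+ UnitAddCircle) := inferInstanceAs (Module Rᵈᵐᵃ (M →+ UnitAddCircle))
  have smul_char (r : R) (χ : M →+ UnitAddCircle) (m : M) :
      (MulOpposite.op r • χ) m = χ (r • m) := rfl
  let e : M →ₗ[R] CircleDual (M →+ UnitAddCircle) :=
    { toFun := fun m => AddMonoidHom.eval m
      map_add' := fun m m' => CircleDual.ext fun χ => map_add χ m m'
      map_smul' := fun r m => CircleDual.ext fun χ => rfl }
  have he (m : M) (χ : M →+ UnitAddCircle) : e m χ = χ m := rfl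
  refine ⟨ModuleCat.of R (CircleDual (M →+ UnitAddCircle)), e,
    isPureInjective_of_compactSpace (R := R) (CircleDual (M →+ UnitAddCircle)), ?_⟩
  rintro m n r a ⟨b, hb⟩
  let T : (Fin n → M) →+ (Fin m → M) :=
    { toFun := fun x i => ∑ j, r i j • x j
      map_zero' := by ext; simp
      map_add' := fun x y => by ext; simp [Finset.sum_add_distrib] }
  by_contra hcon
  have ha : a ∉ T.range := fun ⟨x, hx⟩ => hcon ⟨x, fun i => (congrFun hx i).symm⟩
  obtain ⟨ψ, hψ, hψa⟩ := exists_circle_character_of_notMem _ ha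
  let χ (i : Fin m) : M →+ UnitAddCircle := ψ.comp (AddMonoidHom.single (fun _ => M) i)
  have hχ (x : Fin m → M) : ψ x = ∑ i, χ i (x i) := by
    conv_lhs => rw [← Finset.univ_sum_single x]
    rw [map_sum]
    rfl
  have hχr (j : Fin n) : ∑ i, MulOpposite.op (r i j) • χ i = 0 := by
    ext y
    have h := hψ (T (Pi.single j y)) ⟨_, rfl⟩
    rw [hχ] at h
    rw [AddMonoidHom.finsetSum_apply, AddMonoidHom.zero_apply, ← h]
    refine Finset.sum_congr rfl fun i _ => ?_
    change χ i (r i j • y) = χ i (∑ k, r i k • (Pi.single j y : Fin n → M) k)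
    rw [Finset.sum_eq_single j (fun k _ hk => by simp [hk]) (by simp), Pi.single_eq_same]
  have sum_eval (s : Finset (Fin n)) (φ : Fin n → CircleDual (M →+ UnitAddCircle))
      (x : M →+ UnitAddCircle) : (∑ j ∈ s, φ j) x = ∑ j ∈ s, φ j x :=
    AddMonoidHom.finsetSum_apply φ s x
  apply hψa
  calc ψ a = ∑ i, e (a i) (χ i) := hχ a
    _ = ∑ i, ∑ j, b j (MulOpposite.op (r i j) • χ i) :=
      Finset.sum_congr rfl fun i _ => by
        rw [hb]
        exact sum_eval _ _ _
    _ = ∑ j, b j (∑ i, MulOpposite.op (r i j) • χ i) := by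
      rw [Finset.sum_comm]
      exact Finset.sum_congr rfl fun j _ =>
        (map_sum (b j : (M →+ UnitAddCircle) →+ UnitAddCircle) _ _).symm
    _ = 0 := Finset.sum_eq_zero fun j _ => by
      rw [hχr]
      exact map_zero (b j : (M →+ UnitAddCircle) →+ UnitAddCircle)

end PureEmbedding

/-! ### Minimal idempotents in compact semigroups -/

/-- A compact subsemigroup `s` of a Hausdorff semigroup with continuous right multiplications
contains an idempotent `p` such that `p * s * p` is a group. -/
theorem exists_idempotent_forall_exists_inverse {S : Type*} [Semigroup S] [TopologicalSpace S]
    [T2Space S] (continuous_mul_const : ∀ r : S, Continuous (· * r)) (s : Set S)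
    (s_nonempty : s.Nonempty) (s_compact : IsCompact s) (s_mul : ∀ x ∈ s, ∀ y ∈ s, x * y ∈ s) :
    ∃ p ∈ s, p * p = p ∧
      ∀ x ∈ s, p * x = x → x * p = x → ∃ y ∈ s, x * y = p ∧ y * x = p := by
  let 𝓛 : Set (Set S) :=
    {L | IsClosed L ∧ L.Nonempty ∧ L ⊆ s ∧ ∀ x ∈ s, ∀ y ∈ L, x * y ∈ L}
  obtain ⟨L, -, hL⟩ : ∃ L, L ⊆ s ∧ Minimal (· ∈ 𝓛) L := by
    refine zorn_superset_nonempty 𝓛 (fun c hc hchain hne => ?_) s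
      ⟨s_compact.isClosed, s_nonempty, subset_rfl, s_mul⟩
    refine ⟨⋂₀ c, ⟨isClosed_sInter fun t ht => (hc ht).1, ?_, ?_, fun x hx y hy t ht =>
      (hc ht).2.2.2 x hx y (hy t ht)⟩, fun t ht => Set.sInter_subset_of_mem ht⟩
    · rw [Set.sInter_eq_iInter]
      have := hne.coe_sort
      exact IsCompact.nonempty_iInter_of_directed_nonempty_isCompact_isClosed _
        (DirectedOn.directed_val (IsChain.directedOn hchain.symm)) (fun t => (hc t.2).2.1)
        (fun t => s_compact.of_isClosed_subset (hc t.2).1 (hc t.2).2.2.1) fun t => (hc t.2).1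
    · obtain ⟨t, ht⟩ := hne
      exact (Set.sInter_subset_of_mem ht).trans (hc ht).2.2.1
  obtain ⟨L_closed, L_nonempty, L_sub, L_mul⟩ := hL.prop
  obtain ⟨p, hpL, hp⟩ := exists_idempotent_in_compact_subsemigroup continuous_mul_const L
    L_nonempty (s_compact.of_isClosed_subset L_closed L_sub)
    fun x hx y hy => L_mul x (L_sub hx) y hy
  have hps := L_sub hpL
  have left_inverse (x : S) (hx : x ∈ s) (hpx : p * x = x) (hxp : x * p = x) :
      ∃ y ∈ s, p * y = y ∧ y * p = y ∧ y * x = p := by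
    have hxL : x ∈ L := hxp ▸ L_mul x hx p hpL
    have hsx : (· * x) '' s ∈ 𝓛 := by
      refine ⟨(s_compact.image (continuous_mul_const x)).isClosed, s_nonempty.image _, ?_, ?_⟩
      · rintro _ ⟨y, hy, rfl⟩
        exact s_mul y hy x hx
      · rintro z hz _ ⟨y, hy, rfl⟩
        exact ⟨z * y, s_mul z hz y hy, mul_assoc z y x⟩
    obtain ⟨y, hy, hyx⟩ : p ∈ (· * x) '' s := by
      refine hL.le_of_le hsx ?_ hpL
      rintro _ ⟨y, hy, rfl⟩
      exact L_mul y hy x hxL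
    have hyx' : y * x = p := hyx
    refine ⟨p * y * p, s_mul _ (s_mul p hps y hy) p hps, ?_, ?_, ?_⟩
    · rw [← mul_assoc, ← mul_assoc, hp]
    · rw [mul_assoc, hp]
    · rw [mul_assoc, hpx, mul_assoc, hyx', hp]
  refine ⟨p, hps, hp, fun x hx hpx hxp => ?_⟩
  obtain ⟨y, hy, hpy, hyp, hyx⟩ := left_inverse x hx hpx hxp
  obtain ⟨z, -, -, hzp, hzy⟩ := left_inverse y hy hpy hyp
  have hzx : z = x := by rw [← hzp, ← hyx, ← mul_assoc, hzy, hpx]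
  exact ⟨y, hy, hzx ▸ hzy, hyx⟩

/-! ### Coneat injective envelopes -/

section Envelopes

variable {R : Type u} [Ring R]

/-- An endomorphism of a compact module fixing a given submodule can be chosen idempotent with
the homomorphism to its image left minimal. -/
theorem exists_idempotent_endomorphism_leftMinimal {M E : Type u} [AddCommGroup M] [Module R M]
    [AddCommGroup E] [Module R E] [TopologicalSpace E] [ContinuousAdd E]
    [ContinuousConstSMul R E] [CompactSpace E] [T2Space E] (e : M →ₗ[R] E) :
    ∃ p : E →ₗ[R] E, p.comp e = e ∧ p.comp p = p ∧
      ∀ x : E →ₗ[R] E, x.comp e = e → p.comp x = x → x.comp p = x →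
        ∃ y : E →ₗ[R] E, x.comp y = p ∧ y.comp x = p := by
  let : TopologicalSpace (Function.End E) := inferInstanceAs (TopologicalSpace (E → E))
  have : T2Space (Function.End E) := inferInstanceAs (T2Space (E → E))
  have : CompactSpace (Function.End E) := inferInstanceAs (CompactSpace (E → E))
  let s : Set (Function.End E) := {θ | ∃ l : E →ₗ[R] E, l.comp e = e ∧ ⇑l = θ}
  have hs : IsClosed s := by
    have h : s = Set.range (fun l : E →ₗ[R] E => (l : E → E)) ∩
        ⋂ m, {θ : E → E | θ (e m) = e m} := by
      ext θ
      constructor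
      · rintro ⟨l, hl, rfl⟩
        exact ⟨⟨l, rfl⟩, Set.mem_iInter.2 fun m => LinearMap.congr_fun hl m⟩
      · rintro ⟨⟨l, rfl⟩, hl⟩
        exact ⟨l, LinearMap.ext fun m => Set.mem_iInter.1 hl m, rfl⟩
    rw [h]
    exact (LinearMap.isClosed_range_coe E E (RingHom.id R)).inter
      (isClosed_iInter fun m => isClosed_eq (continuous_apply (e m)) continuous_const)
  obtain ⟨_, ⟨p, hpe, rfl⟩, hpp, hp⟩ := exists_idempotent_forall_exists_inverse
    (S := Function.End E)
    (fun r => continuous_pi fun x => continuous_apply (A := fun _ : E => E) (r x)) s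
    ⟨_, LinearMap.id, LinearMap.id_comp e, rfl⟩ hs.isCompact (by
      rintro _ ⟨l, hl, rfl⟩ _ ⟨k, hk, rfl⟩
      exact ⟨l.comp k, by rw [LinearMap.comp_assoc, hk, hl], rfl⟩)
  refine ⟨p, hpe, DFunLike.coe_injective hpp, fun x hxe hpx hxp => ?_⟩
  obtain ⟨_, ⟨y, -, rfl⟩, hxy, hyx⟩ := hp ⇑x ⟨x, hxe, rfl⟩ (congrArg DFunLike.coe hpx)
    (congrArg DFunLike.coe hxp)
  exact ⟨y, DFunLike.coe_injective hxy, DFunLike.coe_injective hyx⟩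

theorem exists_coneatInjectiveEnvelope (M : Type u) [AddCommGroup M] [Module R M] :
    ∃ (X : ModuleCat.{u} R) (e : M →ₗ[R] X),
      IsConeatInjectiveEnvelope R e ∧ IsPureInjective R X := by
  obtain ⟨E, e, _, _, _, _, _, he, hcon, hE⟩ :=
    exists_compact_coneatInjective_extension (R := R) M
  obtain ⟨p, hpe, hpp, hp⟩ := exists_idempotent_endomorphism_leftMinimal e
  let X := LinearMap.range p
  let r : E →ₗ[R] X := p.rangeRestrict
  let i : X →ₗ[R] E := X.subtype
  have hir : i.comp r = p := rfl
  have hri : r.comp i = LinearMap.id := by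
    refine LinearMap.ext ?_
    rintro ⟨_, z, rfl⟩
    exact Subtype.ext (LinearMap.congr_fun hpp z)
  have hre : i.comp (r.comp e) = e := hpe
  refine ⟨ModuleCat.of R X, r.comp e, ⟨?_, ?_, ?_, ?_⟩, ?_⟩
  · refine Function.Injective.of_comp (f := i) ?_
    rw [← LinearMap.coe_comp, hre]
    exact he
  · exact IsInjectiveRel.of_retract (P := fun _ A => IsConeatSubmodule R A) hE i r hri
  · intro C hC g
    obtain ⟨h, hh⟩ := exists_extension_of_range he (hC E _ hcon) g
    exact ⟨h.comp i, by rw [LinearMap.comp_assoc]; exact (congrArg h.comp hre).trans hh⟩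
  · intro f hf
    let f' : X →ₗ[R] X := f
    have hf' : f'.comp (r.comp e) = r.comp e := hf
    obtain ⟨y, hxy, hyx⟩ := hp (i.comp (f'.comp r))
      (by
        rw [LinearMap.comp_assoc, LinearMap.comp_assoc, hf', hre])
      (by
        rw [← hir, LinearMap.comp_assoc, ← LinearMap.comp_assoc (f'.comp r) i r, hri,
          LinearMap.id_comp])
      (by
        rw [LinearMap.comp_assoc, LinearMap.comp_assoc]
        conv_lhs => rw [← hir, ← LinearMap.comp_assoc r i r, hri, LinearMap.id_comp])
    have hi : Function.Injective i := Subtype.val_injective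
    have hpi (z : X) : p (i z) = i z := congrArg i (LinearMap.congr_fun hri z)
    have hfr (z : X) : i (f' (r (i z))) = i (f' z) :=
      congrArg (fun w => i (f' w)) (LinearMap.congr_fun hri z)
    refine ⟨fun a b hab => hi ?_, fun b => ⟨r (y (i b)), hi ?_⟩⟩
    · have key (z : X) : y (i (f' z)) = i z :=
        (congrArg y (hfr z)).symm.trans ((LinearMap.congr_fun hyx (i z)).trans (hpi z))
      exact (key a).symm.trans ((congrArg (fun w => y (i w)) hab).trans (key b))
    · exact (LinearMap.congr_fun hxy (i b)).trans (hpi b)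
  · exact IsInjectiveRel.of_retract (P := fun _ A => IsPureSubmodule R A)
      (isPureInjective_of_compactSpace (R := R) E) i r hri

/-- If `M → E` is a coneat injective envelope, then so is `M × E → E × E`. -/
theorem IsConeatInjectiveEnvelope.prodMap_id {M E : Type u} [AddCommGroup M] [Module R M]
    [AddCommGroup E] [Module R E] {e : M →ₗ[R] E} (he : IsConeatInjectiveEnvelope R e) :
    IsConeatInjectiveEnvelope R (e.prodMap (LinearMap.id : E →ₗ[R] E)) := by
  obtain ⟨he_inj, hE, hfac, hmin⟩ := he
  refine ⟨Function.Injective.prodMap he_inj Function.injective_id,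
    IsInjectiveRel.prod (P := fun _ A => IsConeatSubmodule R A) hE hE, fun C hC g => ?_,
    fun f hf => ?_⟩
  · obtain ⟨h, hh⟩ := hfac C hC (g.comp (LinearMap.inl R M E))
    refine ⟨h.coprod (g.comp (LinearMap.inr R M E)), LinearMap.ext fun ⟨m, x⟩ => ?_⟩
    have hm : h (e m) = g (m, 0) := LinearMap.congr_fun hh m
    simp [hm, ← map_add]
  · have hf' (m : M) (x : E) : f (e m, x) = (e m, x) := LinearMap.congr_fun hf (m, x)
    let α : E →ₗ[R] E := (LinearMap.fst R E E).comp (f.comp (LinearMap.inl R E E))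
    have hα : Function.Bijective α := hmin α <| LinearMap.ext fun m => by
      change (f (e m, 0)).1 = e m
      rw [hf']
    have hfx (x y : E) : f (x, y) = (α x, (f (x, 0)).2 + y) := by
      have h0 : f (0, y) = (0, y) := by simpa using hf' 0 y
      have : f (x, y) = f (x, 0) + f (0, y) := by rw [← map_add]; simp
      rw [this, h0]
      exact Prod.ext (add_zero _) rfl
    constructor
    · rintro ⟨x, y⟩ ⟨x', y'⟩ h
      rw [hfx x y, hfx x' y', Prod.mk.injEq] at h
      obtain rfl := hα.1 h.1
      rw [add_left_cancel h.2]
    · rintro ⟨x, y⟩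
      obtain ⟨x', rfl⟩ := hα.2 x
      exact ⟨(x', y - (f (x', 0)).2), by rw [hfx]; simp⟩

end Envelopes

/-! ### Comparison of the four conditions -/

section Equivalence

variable {R : Type u} [Ring R]

theorem IsConeatSubmodule.isPureSubmodule
    (h : ∀ M : ModuleCat.{u} R, IsPureInjective R M → IsConeatInjective R M)
    {B : ModuleCat.{u} R} {A : Submodule R B} (hA : IsConeatSubmodule R A) :
    IsPureSubmodule R A := by
  obtain ⟨P, e, hP, hsol⟩ := exists_pureInjective_reflecting_solutions (R := R) A
  obtain ⟨g, hg⟩ := h P hP B A hA e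
  rintro m n r a ⟨b, hb⟩
  obtain ⟨a', ha'⟩ := hsol m n r a ⟨fun j => g (b j), fun i => by
    rw [← hg, LinearMap.comp_apply, Submodule.subtype_apply, hb]
    simp⟩
  exact ⟨a', fun i => by simpa using congrArg Subtype.val (ha' i)⟩

theorem isConeatInjective_of_forall_quasi
    (h : ∀ M : ModuleCat.{u} R, IsPureInjective R M → IsQuasiConeatInjective R M)
    {M : Type u} [AddCommGroup M] [Module R M] (hM : IsPureInjective R M) :
    IsConeatInjective R M := by
  intro B A hA f
  obtain ⟨E, e, _, _, _, _, _, he, hcon, -⟩ :=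
    exists_compact_coneatInjective_extension (R := R) B
  have hX : IsPureInjective R (M × E) := IsInjectiveRel.prod
    (P := fun _ A => IsPureSubmodule R A) hM (isPureInjective_of_compactSpace (R := R) E)
  let k : B →ₗ[R] M × E := (LinearMap.inr R M E).comp e
  let j : A →ₗ[R] M × E := k.comp A.subtype
  have hj : Function.Injective j :=
    (LinearMap.inr_injective.comp he).comp Subtype.val_injective
  have hjcon : IsConeatSubmodule R (LinearMap.range j) := by
    rintro I hI _ ⟨a, rfl⟩ ha
    have h1 : e a ∈ rIdealSMul R I (Set.univ : Set E) :=
      map_mem_rIdealSMul (LinearMap.snd R M E) (Set.mapsTo_univ _ _) ha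
    have h2 : (a : B) ∈ rIdealSMul R I (A : Set B) :=
      hA I hI a a.2 (mem_rIdealSMul_of_map_mem he (hcon I hI _ ⟨a, rfl⟩ h1))
    exact map_mem_rIdealSMul k (fun b hb => LinearMap.mem_range_self j ⟨b, hb⟩) h2
  obtain ⟨g, hg⟩ := exists_extension_of_range hj (h (ModuleCat.of R (M × E)) hX _ hjcon)
    ((LinearMap.inl R M E).comp f)
  exact ⟨(LinearMap.fst R M E).comp (g.comp k),
    LinearMap.ext fun a => congrArg Prod.fst (LinearMap.congr_fun hg a)⟩

theorem IsConeatInjective.isConeatQuasiInjective {M : Type u} [AddCommGroup M] [Module R M]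
    (hM : IsConeatInjective R M) : IsConeatQuasiInjective R M := by
  rintro E e ⟨-, -, hfac, hmin⟩ f n
  obtain ⟨h, hh⟩ := hfac (ModuleCat.of R M) hM LinearMap.id
  obtain ⟨x, hx⟩ := (hmin (e.comp h) (by
    rw [LinearMap.comp_assoc]; exact congrArg e.comp hh)).2 (f n)
  exact ⟨h x, hx⟩

theorem isConeatInjective_of_forall_coneatQuasi
    (h : ∀ M : ModuleCat.{u} R, IsPureInjective R M → IsConeatQuasiInjective R M)
    {M : Type u} [AddCommGroup M] [Module R M] (hM : IsPureInjective R M) :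
    IsConeatInjective R M := by
  obtain ⟨E, e, he, hE⟩ := exists_coneatInjectiveEnvelope (R := R) M
  have hX : IsPureInjective R (M × E) :=
    IsInjectiveRel.prod (P := fun _ A => IsPureSubmodule R A) hM hE
  have hsurj : Function.Surjective e := fun x => by
    obtain ⟨⟨m, y⟩, hm⟩ := h (ModuleCat.of R (M × E)) hX (ModuleCat.of R (E × E)) _ he.prodMap_id
      ((LinearMap.snd R M E).prod (e.comp (LinearMap.fst R M E))) (0, x)
    exact ⟨m, congrArg Prod.fst hm⟩
  let ε := LinearEquiv.ofBijective e ⟨he.1, hsurj⟩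
  exact IsInjectiveRel.of_retract (P := fun _ A => IsConeatSubmodule R A) he.2.1
    ε.toLinearMap ε.symm.toLinearMap (LinearMap.ext fun m => ε.symm_apply_apply m)

end Equivalence

/-- The following are equivalent for a ring `R`: (1) every coneat exact
sequence of left `R`-modules is pure exact; (2) every pure injective left `R`-module is coneat
injective; (3) every pure injective left `R`-module is quasi coneat injective; (4) every pure
injective left `R`-module is coneat quasi injective. -/
theorem coneat_implies_pure_tfae (R : Type u) [Ring R] :
    ((∀ (A B C : ModuleCat.{u} R) (f : A →ₗ[R] B) (g : B →ₗ[R] C),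
        IsConeatExactSeq R f g → IsPureExactSeq R f g) ↔
      (∀ M : ModuleCat.{u} R, IsPureInjective R M → IsConeatInjective R M)) ∧
    ((∀ M : ModuleCat.{u} R, IsPureInjective R M → IsConeatInjective R M) ↔
      (∀ M : ModuleCat.{u} R, IsPureInjective R M → IsQuasiConeatInjective R M)) ∧
    ((∀ M : ModuleCat.{u} R, IsPureInjective R M → IsQuasiConeatInjective R M) ↔
      (∀ M : ModuleCat.{u} R, IsPureInjective R M → IsConeatQuasiInjective R M)) := by
  have quasi : (∀ M : ModuleCat.{u} R, IsPureInjective R M → IsConeatInjective R M) ↔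
      (∀ M : ModuleCat.{u} R, IsPureInjective R M → IsQuasiConeatInjective R M) :=
    ⟨fun h M hM => h M hM M, fun h _ hM => isConeatInjective_of_forall_quasi h hM⟩
  have coneatQuasi : (∀ M : ModuleCat.{u} R, IsPureInjective R M → IsConeatInjective R M) ↔
      (∀ M : ModuleCat.{u} R, IsPureInjective R M → IsConeatQuasiInjective R M) :=
    ⟨fun h M hM => (h M hM).isConeatQuasiInjective,
      fun h _ hM => isConeatInjective_of_forall_coneatQuasi h hM⟩
  refine ⟨⟨fun h M hM B A hA => ?_, ?_⟩, quasi, quasi.symm.trans coneatQuasi⟩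
  · have hpure := h (ModuleCat.of R A) B (ModuleCat.of R (B ⧸ A)) A.subtype A.mkQ
      ⟨Subtype.val_injective, A.mkQ_surjective, LinearMap.exact_subtype_mkQ A,
        by rwa [Submodule.range_subtype]⟩
    exact hM B A (by simpa only [Submodule.range_subtype] using hpure.2.2.2)
  · rintro h A B C f g ⟨hf, hg, hfg, hcon⟩
    exact ⟨hf, hg, hfg, hcon.isPureSubmodule h⟩
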